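/- Let n ∈ ℕ and let S be a finite subset of Z_2^n \ {0}. For w ∈ Z_2^n, let A_w = {v ∈ Z_2^n : ⟨v,w⟩ = 1}, and for k ∈ ℕ let q_k(S) = 2^(−n)·#{w ∈ Z_2^n : |S ∩ A_w| = k}. Let rank(S) be the dimension of the span of S, let I(S) = {v ∈ S : v ∉ span(S \ {v})}, and m(S) = |I(S)|. Then: (1) q_0(S) = 2^(−rank(S)); (2) q_1(S) = m(S)·2^(−rank(S)); (3) if there exists i ∈ [n] such that #{v ∈ S : v_i = 1} is odd, then q_k(S) ≤ 1/2 for every k; (4) for every odd k, q_k(S) ≤ 1/2; (5) q_2(S) ≤ 3/4. -/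

import Mathlib

/-- `q_k(S)`: the probability, over a uniformly random `w ∈ Z_2^n`, that
exactly `k` elements `v` of `S` satisfy `⟨v, w⟩ = 1`. -/
noncomputable def qkVec (n : ℕ) (k : ℕ) (S : Finset (Fin n → ZMod 2)) : ℝ :=
  ((Finset.univ.filter
      (fun w : Fin n → ZMod 2 =>
        (S.filter (fun v => ∑ j : Fin n, v j * w j = 1)).card = k)).card : ℝ) / 2 ^ n

/-- The rank of `S`: the dimension of its span. -/
noncomputable def rankOf (n : ℕ) (S : Finset (Fin n → ZMod 2)) : ℕ :=
  Module.finrank (ZMod 2)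
    (Submodule.span (ZMod 2) (S : Set (Fin n → ZMod 2)))

/-- `m(S)`: the number of elements of `S` lying in no linear dependency of `S`,
i.e. not in the span of the other elements. -/
noncomputable def mOf (n : ℕ) (S : Finset (Fin n → ZMod 2)) : ℕ :=
  Set.ncard {v : Fin n → ZMod 2 | v ∈ S ∧
    v ∉ Submodule.span (ZMod 2) ((S : Set (Fin n → ZMod 2)) \ {v})}

open Finset

/-- The nontrivial additive character of `ZMod 2`, with real values. -/
noncomputable def signChar (x : ZMod 2) : ℝ := if x = 1 then -1 else 1

lemma signChar_zero : signChar 0 = 1 := by simp [signChar]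

lemma signChar_one : signChar 1 = -1 := by simp [signChar]

lemma signChar_add (x y : ZMod 2) : signChar (x + y) = signChar x * signChar y := by
  have h : (1 + 1 : ZMod 2) = 0 := by decide
  have h01 : ∀ z : ZMod 2, z = 0 ∨ z = 1 := by decide
  rcases h01 x with rfl | rfl <;> rcases h01 y with rfl | rfl <;> simp [signChar, h]

lemma signChar_sum {ι : Type*} (T : Finset ι) (f : ι → ZMod 2) :
    signChar (∑ i ∈ T, f i) = (-1) ^ #{i ∈ T | f i = 1} := by
  classical
  induction T using Finset.induction_on with
  | empty => simp [signChar_zero]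
  | insert a T ha ih =>
    rw [sum_insert ha, signChar_add, ih, filter_insert]
    by_cases h : f a = 1
    · rw [if_pos h, card_insert_of_notMem (by simp [ha]), h, signChar_one, pow_succ]
      ring
    · rw [if_neg h]
      simp [signChar, h]

lemma sum_signChar_dotProduct_eq_zero {n : ℕ} {v : Fin n → ZMod 2} (hv : v ≠ 0) :
    ∑ w : Fin n → ZMod 2, signChar (v ⬝ᵥ w) = 0 := by
  obtain ⟨i, hi⟩ := Function.ne_iff.mp hv
  have hi1 : v i = 1 := by
    have : ∀ x : ZMod 2, x ≠ 0 → x = 1 := by decide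
    exact this _ hi
  have h := Equiv.sum_comp (Equiv.addRight (Pi.single i 1 : Fin n → ZMod 2))
    fun w => signChar (v ⬝ᵥ w)
  simp only [Equiv.coe_addRight, dotProduct_add, dotProduct_single, hi1, mul_one, signChar_add,
    signChar_one, mul_neg, sum_neg_distrib] at h
  linarith

lemma sum_signChar_mul_signChar {n : ℕ} (u v : Fin n → ZMod 2) :
    ∑ w : Fin n → ZMod 2, signChar (u ⬝ᵥ w) * signChar (v ⬝ᵥ w) =
      if u = v then 2 ^ n else 0 := by
  simp only [← signChar_add, ← add_dotProduct]
  split_ifs with h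
  · subst h
    have : u + u = 0 := funext fun i => CharTwo.add_self_eq_zero (u i)
    simp [this, signChar_zero, ZMod.card]
  · exact sum_signChar_dotProduct_eq_zero fun h0 => h (funext fun i =>
      CharTwo.add_eq_zero.mp (congrFun h0 i))

/-- The number of `v ∈ S` with `⟨v, w⟩ = 1`. -/
def cutSize {n : ℕ} (S : Finset (Fin n → ZMod 2)) (w : Fin n → ZMod 2) : ℕ :=
  #{v ∈ S | v ⬝ᵥ w = 1}

lemma cutSize_le_card {n : ℕ} (S : Finset (Fin n → ZMod 2)) (w : Fin n → ZMod 2) :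
    cutSize S w ≤ #S := card_filter_le _ _

lemma qkVec_eq {n : ℕ} (k : ℕ) (S : Finset (Fin n → ZMod 2)) :
    qkVec n k S = (#{w : Fin n → ZMod 2 | cutSize S w = k} : ℝ) / 2 ^ n := rfl

lemma signChar_sum_dotProduct {n : ℕ} (S : Finset (Fin n → ZMod 2)) (w : Fin n → ZMod 2) :
    signChar ((∑ v ∈ S, v) ⬝ᵥ w) = (-1) ^ cutSize S w := by
  rw [sum_dotProduct, signChar_sum, cutSize]

lemma sum_signChar_eq_card_sub {n : ℕ} (S : Finset (Fin n → ZMod 2)) (w : Fin n → ZMod 2) :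
    ∑ v ∈ S, signChar (v ⬝ᵥ w) = #S - 2 * cutSize S w := by
  have h : ∀ v ∈ S, signChar (v ⬝ᵥ w) = 1 - 2 * (if v ⬝ᵥ w = 1 then 1 else 0) := by
    intro v _
    rw [signChar]
    split_ifs <;> norm_num
  rw [sum_congr rfl h, sum_sub_distrib, ← mul_sum, sum_boole]
  simp [cutSize]

lemma sum_card_sub_cutSize {n : ℕ} {S : Finset (Fin n → ZMod 2)} (hS : 0 ∉ S) :
    ∑ w : Fin n → ZMod 2, ((#S : ℝ) - 2 * cutSize S w) = 0 := by
  simp only [← sum_signChar_eq_card_sub]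
  rw [sum_comm]
  exact sum_eq_zero fun v hv => sum_signChar_dotProduct_eq_zero fun h => hS (h ▸ hv)

lemma sum_card_sub_cutSize_sq {n : ℕ} (S : Finset (Fin n → ZMod 2)) :
    ∑ w : Fin n → ZMod 2, ((#S : ℝ) - 2 * cutSize S w) ^ 2 = #S * (2 : ℝ) ^ n := by
  simp only [← sum_signChar_eq_card_sub, sq, sum_mul_sum]
  rw [sum_comm]
  simp_rw [sum_comm (s := univ), sum_signChar_mul_signChar]
  simp

/-- The polynomial method: a quadratic in `#S - 2 * cutSize S w` that dominates the indicator of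
`cutSize S w = k` bounds `qkVec n k S`. -/
lemma qkVec_le_of_quadratic {n k : ℕ} {S : Finset (Fin n → ZMod 2)} (hS : 0 ∉ S) (a b c : ℝ)
    (h : ∀ w, (if cutSize S w = k then 1 else 0 : ℝ) ≤
      a + b * (#S - 2 * cutSize S w) + c * (#S - 2 * cutSize S w) ^ 2) :
    qkVec n k S ≤ a + c * #S := by
  rw [qkVec_eq, div_le_iff₀ (by positivity), ← sum_boole]
  refine (sum_le_sum fun w _ => h w).trans_eq ?_
  rw [sum_add_distrib, sum_add_distrib, ← mul_sum, ← mul_sum, sum_card_sub_cutSize hS,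
    sum_card_sub_cutSize_sq]
  simp [ZMod.card]
  ring

lemma qkVec_le_half_of_sum_ne_zero {n : ℕ} (k : ℕ) {S : Finset (Fin n → ZMod 2)}
    (hs : ∑ v ∈ S, v ≠ 0) : qkVec n k S ≤ 1 / 2 := by
  rw [qkVec_eq, div_le_iff₀ (by positivity), ← sum_boole]
  have h : ∀ w, (if cutSize S w = k then 1 else 0 : ℝ) ≤
      1 / 2 + (-1) ^ k / 2 * signChar ((∑ v ∈ S, v) ⬝ᵥ w) := by
    intro w
    rw [signChar_sum_dotProduct]
    split_ifs with hk
    · rw [hk, div_mul_eq_mul_div, ← mul_pow]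
      norm_num
    · rcases neg_one_pow_eq_or ℝ k with h | h <;>
        rcases neg_one_pow_eq_or ℝ (cutSize S w) with h' | h' <;> norm_num [h, h']
  refine (sum_le_sum fun w _ => h w).trans_eq ?_
  rw [sum_add_distrib, ← mul_sum, sum_signChar_dotProduct_eq_zero hs]
  simp [ZMod.card]
  ring

lemma even_cutSize_of_sum_eq_zero {n : ℕ} {S : Finset (Fin n → ZMod 2)}
    (hs : ∑ v ∈ S, v = 0) (w : Fin n → ZMod 2) : Even (cutSize S w) := by
  have h := signChar_sum_dotProduct S w
  rw [hs, zero_dotProduct, signChar_zero] at h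
  exact neg_one_pow_eq_one_iff_even (by norm_num : (-1 : ℝ) ≠ 1) |>.mp h.symm

lemma sum_ne_zero_of_odd_card {n : ℕ} {S : Finset (Fin n → ZMod 2)} {i : Fin n}
    (hi : Odd #{v ∈ S | v i = 1}) : ∑ v ∈ S, v ≠ 0 := by
  intro hs
  have h := signChar_sum S fun v => v i
  rw [hi.neg_one_pow, ← Finset.sum_apply, hs, Pi.zero_apply, signChar_zero] at h
  norm_num at h

lemma qkVec_le_half_of_odd {n k : ℕ} (S : Finset (Fin n → ZMod 2)) (hk : Odd k) :
    qkVec n k S ≤ 1 / 2 := by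
  by_cases hs : ∑ v ∈ S, v = 0
  · have : ({w : Fin n → ZMod 2 | cutSize S w = k} : Finset _) = ∅ :=
      filter_eq_empty_iff.mpr fun w _ hw =>
        Nat.not_even_iff_odd.mpr hk (hw ▸ even_cutSize_of_sum_eq_zero hs w)
    rw [qkVec_eq, this]
    norm_num
  · exact qkVec_le_half_of_sum_ne_zero k hs

lemma qkVec_two_le {n : ℕ} {S : Finset (Fin n → ZMod 2)} (hS : 0 ∉ S) :
    qkVec n 2 S ≤ 3 / 4 := by
  by_cases hs : ∑ v ∈ S, v = 0
  swap
  · exact (qkVec_le_half_of_sum_ne_zero 2 hs).trans (by norm_num)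
  rcases le_or_gt #S 5 with hN | hN
  · have hq := qkVec_le_of_quadratic (k := 2) hS (#S * (8 - #S) / 16 : ℝ) ((#S - 4) / 8)
      (-1 / 16) fun w => by
        have hle := (cutSize_le_card S w).trans hN
        have heven := even_cutSize_of_sum_eq_zero hs w
        generalize cutSize S w = x at *
        suffices (if x = 2 then 1 else 0 : ℝ) ≤ x * (4 - x) / 4 by
          refine this.trans_eq ?_
          ring
        interval_cases x <;> first | (norm_num; done) | exact absurd heven (by norm_num [Nat.even_iff])
    refine hq.trans ?_
    generalize #S = N at *
    interval_cases N <;> norm_num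
  · have hN' : (6 : ℝ) ≤ #S := by exact_mod_cast hN
    generalize hc : (#S : ℝ) = N at *
    have hpos : 0 < (N - 2) ^ 2 := by nlinarith
    have hq := qkVec_le_of_quadratic (k := 2) hS (4 / (N - 2) ^ 2) (4 / (N - 2) ^ 2)
      (1 / (N - 2) ^ 2) fun w => by
        rw [hc]
        suffices (if cutSize S w = 2 then 1 else 0 : ℝ) ≤
            (N - 2 * cutSize S w + 2) ^ 2 / (N - 2) ^ 2 by
          refine this.trans_eq ?_
          ring
        split_ifs with h
        · rw [le_div_iff₀ hpos, h]
          push_cast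
          nlinarith
        · positivity
    refine hq.trans ?_
    rw [hc, div_mul_eq_mul_div, ← add_div, div_le_iff₀ hpos]
    nlinarith

/-- The size of the orthogonal complement of a set of vectors. -/
lemma card_orthogonal_mul_two_pow {n : ℕ} (T : Set (Fin n → ZMod 2)) :
    Nat.card {w : Fin n → ZMod 2 // ∀ v ∈ T, v ⬝ᵥ w = 0} *
      2 ^ Module.finrank (ZMod 2) (Submodule.span (ZMod 2) T) = 2 ^ n := by
  set W := Submodule.span (ZMod 2) T
  have e : {w : Fin n → ZMod 2 // ∀ v ∈ T, v ⬝ᵥ w = 0} ≃ W.dualAnnihilator :=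
    (dotProductEquiv (ZMod 2) (Fin n)).toEquiv.subtypeEquiv fun w => by
      change _ ↔ dotProductEquiv (ZMod 2) (Fin n) w ∈ W.dualAnnihilator
      rw [← SetLike.mem_coe, Submodule.coe_dualAnnihilator_span]
      simp only [Set.mem_ofPred_eq, Set.subset_def, SetLike.mem_coe, LinearMap.mem_ker]
      simp [dotProduct_comm w]
  rw [Nat.card_congr e, Module.natCard_eq_pow_finrank (K := ZMod 2), Nat.card_zmod, ← pow_add,
    add_comm, Subspace.finrank_add_finrank_dualAnnihilator_eq]
  simp

lemma card_orthogonal {n : ℕ} (T : Set (Fin n → ZMod 2)) :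
    (Nat.card {w : Fin n → ZMod 2 // ∀ v ∈ T, v ⬝ᵥ w = 0} : ℝ) =
      2 ^ n * (2 ^ Module.finrank (ZMod 2) (Submodule.span (ZMod 2) T))⁻¹ := by
  rw [eq_mul_inv_iff_mul_eq₀ (by positivity)]
  exact_mod_cast card_orthogonal_mul_two_pow T

lemma ne_one_iff_eq_zero_zmod_two : ∀ x : ZMod 2, x ≠ 1 ↔ x = 0 := by decide

lemma qkVec_zero {n : ℕ} (S : Finset (Fin n → ZMod 2)) :
    qkVec n 0 S = ((2 : ℝ) ^ rankOf n S)⁻¹ := by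
  rw [qkVec_eq, div_eq_iff (by positivity), mul_comm, rankOf, ← card_orthogonal,
    Nat.card_eq_fintype_card, Fintype.card_subtype]
  congr! 3 with w
  simp [cutSize, filter_eq_empty_iff, ne_one_iff_eq_zero_zmod_two]

/-- The number of `w` for which `v` is the only element of `S` with `⟨v, w⟩ = 1`. -/
lemma card_filter_eq_singleton {n : ℕ} {S : Finset (Fin n → ZMod 2)} {v : Fin n → ZMod 2}
    (hv : v ∈ S) [Decidable (v ∉ Submodule.span (ZMod 2) ((S : Set (Fin n → ZMod 2)) \ {v}))] :
    (#{w : Fin n → ZMod 2 | {u ∈ S | u ⬝ᵥ w = 1} = {v}} : ℝ) =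
      if v ∉ Submodule.span (ZMod 2) ((S : Set (Fin n → ZMod 2)) \ {v}) then
        2 ^ n * ((2 : ℝ) ^ rankOf n S)⁻¹ else 0 := by
  classical
  set T : Set (Fin n → ZMod 2) := (S : Set (Fin n → ZMod 2)) \ {v} with hT
  have hins : (S : Set (Fin n → ZMod 2)) = insert v T := by
    rw [hT, Set.insert_sdiff_singleton, Set.insert_eq_of_mem (by exact_mod_cast hv)]
  have hcard : (#{w : Fin n → ZMod 2 | {u ∈ S | u ⬝ᵥ w = 1} = {v}} : ℝ) +
      Nat.card {w : Fin n → ZMod 2 // ∀ u ∈ (S : Set (Fin n → ZMod 2)), u ⬝ᵥ w = 0} =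
      Nat.card {w : Fin n → ZMod 2 // ∀ u ∈ T, u ⬝ᵥ w = 0} := by
    simp only [Nat.card_eq_fintype_card, Fintype.card_subtype]
    norm_cast
    rw [← card_union_of_disjoint]
    · congr 1
      ext w
      have h2 := ne_one_iff_eq_zero_zmod_two
      have hsing : {u ∈ S | u ⬝ᵥ w = 1} = {v} ↔ v ⬝ᵥ w = 1 ∧ ∀ u ∈ T, u ⬝ᵥ w = 0 := by
        rw [eq_singleton_iff_unique_mem]
        simp only [mem_filter, hv, true_and, hT, Set.mem_sdiff, mem_coe, Set.mem_singleton_iff,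
          ← h2]
        refine and_congr_right fun _ => forall_congr' fun u => ?_
        tauto
      have hall : (∀ u ∈ S, u ⬝ᵥ w = 0) ↔ v ⬝ᵥ w ≠ 1 ∧ ∀ u ∈ T, u ⬝ᵥ w = 0 := by
        have := Set.forall_mem_insert (P := fun u => u ⬝ᵥ w = 0) (a := v) (s := T)
        rwa [← hins, ← h2 (v ⬝ᵥ w)] at this
      simp only [mem_union, mem_filter, mem_univ, true_and, hsing, hall]
      tauto
    · rw [disjoint_filter]
      intro w _ h1 h0
      have hvw : v ∈ ({u ∈ S | u ⬝ᵥ w = 1} : Finset _) := by simp [h1]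
      exact zero_ne_one ((h0 v hv).symm.trans (mem_filter.mp hvw).2)
  rw [card_orthogonal, card_orthogonal] at hcard
  rw [rankOf]
  by_cases h : v ∈ Submodule.span (ZMod 2) T
  · rw [hins, Submodule.span_insert_eq_span h] at hcard
    rw [if_neg (not_not.mpr h)]
    linarith
  · rw [if_pos h]
    have hr : Module.finrank (ZMod 2) (Submodule.span (ZMod 2) (S : Set (Fin n → ZMod 2))) =
        Module.finrank (ZMod 2) (Submodule.span (ZMod 2) T) + 1 := by
      rw [hins, Submodule.span_insert, sup_comm]
      exact Submodule.finrank_sup_span_singleton h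
    rw [hr, pow_succ, mul_inv] at hcard ⊢
    linarith

lemma qkVec_one {n : ℕ} (S : Finset (Fin n → ZMod 2)) :
    qkVec n 1 S = (mOf n S : ℝ) * ((2 : ℝ) ^ rankOf n S)⁻¹ := by
  classical
  have hm : mOf n S =
      #{v ∈ S | v ∉ Submodule.span (ZMod 2) ((S : Set (Fin n → ZMod 2)) \ {v})} := by
    rw [mOf, ← Set.ncard_coe_finset]
    simp
  have hunion : ({w : Fin n → ZMod 2 | cutSize S w = 1} : Finset _) =
      S.biUnion fun v => {w : Fin n → ZMod 2 | {u ∈ S | u ⬝ᵥ w = 1} = {v}} := by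
    ext w
    simp only [cutSize, card_eq_one, mem_filter, mem_univ, true_and, mem_biUnion]
    refine exists_congr fun v => ⟨fun h => ⟨?_, h⟩, And.right⟩
    exact filter_subset _ _ (h ▸ mem_singleton_self v)
  rw [qkVec_eq, hunion, card_biUnion, Nat.cast_sum, sum_congr rfl fun v hv =>
    card_filter_eq_singleton hv, ← sum_filter, sum_const, ← hm, nsmul_eq_mul]
  · field_simp
  · intro u _ v _ huv
    change Disjoint _ _
    rw [disjoint_filter]
    intro w _ hu hv
    exact huv (singleton_injective (hu.symm.trans hv))

theorem vector_cut_statistics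
    (n : ℕ) (S : Finset (Fin n → ZMod 2)) (hS : (0 : Fin n → ZMod 2) ∉ S) :
    (qkVec n 0 S = ((2 : ℝ) ^ rankOf n S)⁻¹) ∧
    (qkVec n 1 S = (mOf n S : ℝ) * ((2 : ℝ) ^ rankOf n S)⁻¹) ∧
    ((∃ i : Fin n, Odd (S.filter (fun v => v i = 1)).card) →
      ∀ k : ℕ, qkVec n k S ≤ 1 / 2) ∧
    (∀ k : ℕ, Odd k → qkVec n k S ≤ 1 / 2) ∧
    (qkVec n 2 S ≤ 3 / 4) := by
  exact ⟨qkVec_zero S, qkVec_one S,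
    fun ⟨_, hi⟩ k => qkVec_le_half_of_sum_ne_zero k (sum_ne_zero_of_odd_card hi),
    fun _ hk => qkVec_le_half_of_odd S hk, qkVec_two_le hS⟩
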